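/- For all integers u, v, one has (2/7 − u)² + (2/7 − u)·(3/7 − v) + 2·(3/7 − v)² ≥ 4/7. That is, the Euclidean minimum of the point (2/7, 3/7) in ℚ(√−7) is at least 4/7 = M(ℚ(√−7)), so the bound M = 4/7 in the division theorem for m = −7 cannot be improved. -/

import Mathlib

/-- the Euclidean minimum of the point (2/7, 3/7) in ℚ(√−7) is at
least 4/7. -/
theorem stmt_11 (u v : ℤ) :
    (2/7 - (u : ℝ)) ^ 2 + (2/7 - (u : ℝ)) * (3/7 - (v : ℝ)) + 2 * (3/7 - (v : ℝ)) ^ 2 ≥ 4/7 := by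
  have h : -1 < u ^ 2 + u * v + 2 * v ^ 2 - u - 2 * v := by
    nlinarith [sq_nonneg (2 * u + v - 1), sq_nonneg (7 * v - 3)]
  have h0 : 0 ≤ u ^ 2 + u * v + 2 * v ^ 2 - u - 2 * v := by linarith [Int.add_one_le_iff.mpr h]
  have h1 : (0 : ℝ) ≤ (u : ℝ) ^ 2 + u * v + 2 * (v : ℝ) ^ 2 - u - 2 * v := by exact_mod_cast h0
  linarith
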